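/- With A the 6×4×3 marginal map and f the Vlach vector as above: f is a lattice point of the cone generated by the columns of A_{6×4×3} (since Az* = f for the nonnegative vector z* with entries in {0, 1/2, 1}), but f cannot be written as a nonnegative integer combination of the columns of A_{6×4×3}. In other words, f is a hole of the monoid generated by the columns of A_{6×4×3}. -/

import Mathlib

/-- 6×4×3 contingency tables with entries in `α`. -/
abbrev Tab643 (α : Type) := Fin 6 → Fin 4 → Fin 3 → α

/-- The `(j,k)`-marginals (sums over the first index). -/
def margJK (z : Tab643 ℝ) : Fin 4 → Fin 3 → ℝ := fun j k => ∑ i, z i j k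

/-- The `(i,k)`-marginals (sums over the second index). -/
def margIK (z : Tab643 ℝ) : Fin 6 → Fin 3 → ℝ := fun i k => ∑ j, z i j k

/-- The `(i,j)`-marginals (sums over the third index). -/
def margIJ (z : Tab643 ℝ) : Fin 6 → Fin 4 → ℝ := fun i j => ∑ k, z i j k

/-- Vlach's right-hand side: the `(j,k)`-marginals. -/
def f1 : Fin 4 → Fin 3 → ℝ := fun _ _ => 1

/-- Vlach's right-hand side: the `(i,k)`-marginals. -/
def f2 : Fin 6 → Fin 3 → ℝ :=
  ![![1,1,0], ![1,1,0], ![1,0,1], ![1,0,1], ![0,1,1], ![0,1,1]]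

/-- Vlach's right-hand side: the `(i,j)`-marginals. -/
def f3 : Fin 6 → Fin 4 → ℝ :=
  ![![1,0,0,1], ![0,1,1,0], ![1,1,0,0], ![0,0,1,1], ![1,0,1,0], ![0,1,0,1]]

/-- Membership in the transportation polytope `{z ≥ 0 : Az = f}`. -/
def VlachFeas (z : Tab643 ℝ) : Prop :=
  (∀ i j k, 0 ≤ z i j k) ∧ margJK z = f1 ∧ margIK z = f2 ∧ margIJ z = f3

/-- Vlach's vector `f` lies in the cone generated by the columns of the 6×4×3
marginal matrix (it is the image of a nonnegative real table), but it is not a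
nonnegative integer combination of the columns (no table with entries in ℕ maps
to it): `f` is a hole of the monoid. -/
theorem stmt5 :
    (∃ z : Tab643 ℝ, VlachFeas z) ∧
    ¬ ∃ z : Tab643 ℕ,
        margJK (fun i j k => (z i j k : ℝ)) = f1 ∧
        margIK (fun i j k => (z i j k : ℝ)) = f2 ∧
        margIJ (fun i j k => (z i j k : ℝ)) = f3 := by
  constructor
  · refine ⟨fun i j k => f2 i k * f3 i j / 2, ?_, ?_, ?_, ?_⟩
    · intro i j k
      fin_cases i <;> fin_cases j <;> fin_cases k <;> simp [f2, f3]
    · ext j k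
      fin_cases j <;> fin_cases k <;> simp [margJK, f1, f2, f3, Fin.sum_univ_succ] <;> norm_num
    · ext i k
      fin_cases i <;> fin_cases k <;> simp [margIK, f2, f3, Fin.sum_univ_succ] <;> norm_num
    · ext i j
      fin_cases i <;> fin_cases j <;> simp [margIJ, f2, f3, Fin.sum_univ_succ] <;> norm_num
  · rintro ⟨z, h1, h2, h3⟩
    -- transfer the marginal equations to natural numbers
    have e1 : ∀ j k, ∑ i, z i j k = 1 := by
      intro j k
      have h := congrFun (congrFun h1 j) k
      simp only [margJK, f1] at h
      exact_mod_cast h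
    have e2 : ∀ i k, ∑ j, z i j k =
        (![![1,1,0], ![1,1,0], ![1,0,1], ![1,0,1], ![0,1,1], ![0,1,1]] :
          Fin 6 → Fin 3 → ℕ) i k := by
      intro i k
      have h := congrFun (congrFun h2 i) k
      have c : f2 i k = (((![![1,1,0], ![1,1,0], ![1,0,1], ![1,0,1], ![0,1,1], ![0,1,1]] :
          Fin 6 → Fin 3 → ℕ) i k : ℕ) : ℝ) := by
        fin_cases i <;> fin_cases k <;> simp [f2]
      rw [c] at h
      simp only [margIK] at h
      exact_mod_cast h
    have e3 : ∀ i j, ∑ k, z i j k =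
        (![![1,0,0,1], ![0,1,1,0], ![1,1,0,0], ![0,0,1,1], ![1,0,1,0], ![0,1,0,1]] :
          Fin 6 → Fin 4 → ℕ) i j := by
      intro i j
      have h := congrFun (congrFun h3 i) j
      have c : f3 i j = (((![![1,0,0,1], ![0,1,1,0], ![1,1,0,0], ![0,0,1,1], ![1,0,1,0],
          ![0,1,0,1]] : Fin 6 → Fin 4 → ℕ) i j : ℕ) : ℝ) := by
        fin_cases i <;> fin_cases j <;> simp [f3]
      rw [c] at h
      simp only [margIJ] at h
      exact_mod_cast h
    clear h1 h2 h3
    -- entries vanish where a marginal vanishes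
    have z2 : ∀ i j k, (![![1,1,0], ![1,1,0], ![1,0,1], ![1,0,1], ![0,1,1], ![0,1,1]] :
          Fin 6 → Fin 3 → ℕ) i k = 0 → z i j k = 0 := by
      intro i j k h
      have := e2 i k
      rw [h, Finset.sum_eq_zero_iff] at this
      exact this j (Finset.mem_univ j)
    have z3 : ∀ i j k, (![![1,0,0,1], ![0,1,1,0], ![1,1,0,0], ![0,0,1,1], ![1,0,1,0],
          ![0,1,0,1]] : Fin 6 → Fin 4 → ℕ) i j = 0 → z i j k = 0 := by
      intro i j k h
      have := e3 i j
      rw [h, Finset.sum_eq_zero_iff] at this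
      exact this k (Finset.mem_univ k)
    simp only [Fin.forall_fin_succ, Fin.sum_univ_succ] at e1 e2 e3 z2 z3
    simp at e1 e2 e3 z2 z3
    simp_all
    omega
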